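/- arXiv:2002.03232 — 3 statements merged into one kernel-verified Lean document; each statement's English description precedes it below -/
import Mathlib

section
/- Let p be a prime number. For every integer m ≥ 1, τ_m([1/2]) − τ_{m−1}([1/2]) = p^m · [p^{−m}/2]; in particular this divisor is effective and its support is the single point {p^{−m}/2}. -/
open Finsupp

/-- `x_k = (p/(p+1))·p^{-k}`. -/
noncomputable def xk (p k : ℕ) : ℝ := ((p : ℝ) / ((p : ℝ) + 1)) * (p : ℝ) ^ (-(k : ℤ))

/-- The value of the correspondence `τ₁` on the point divisor `[x]`. -/
noncomputable def tauOnePt (p : ℕ) (x : ℝ) : ℝ →₀ ℤ :=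
  if x ≤ 1 / ((p : ℝ) + 1) then
    Finsupp.single ((p : ℝ) * x) 1 + (p : ℤ) • Finsupp.single (x / (p : ℝ)) 1
  else
    Finsupp.single (1 - x) 1 + (p : ℤ) • Finsupp.single (x / (p : ℝ)) 1

/-- The correspondence `τ₁`, extended `ℤ`-linearly to divisors. -/
noncomputable def tauOne (p : ℕ) (D : ℝ →₀ ℤ) : ℝ →₀ ℤ :=
  D.sum fun x n => n • tauOnePt p x

/-- The correspondences `τ_m`: `τ₀ = id`, `τ₁` as above, and
`τ_m = τ₁ ∘ τ_{m-1} - p·τ_{m-2}` for `m ≥ 2`. -/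
noncomputable def tau (p : ℕ) : ℕ → (ℝ →₀ ℤ) → (ℝ →₀ ℤ)
  | 0 => id
  | 1 => tauOne p
  | (m + 2) => fun D => tauOne p (tau p (m + 1) D) - (p : ℤ) • tau p m D

/-- The degree of a divisor. -/
noncomputable def degDiv (D : ℝ →₀ ℤ) : ℤ := D.sum fun _ n => n

lemma tauOne_single (p : ℕ) (x : ℝ) (n : ℤ) :
    tauOne p (Finsupp.single x n) = n • tauOnePt p x :=
  Finsupp.sum_single_index (zero_smul ℤ _)

lemma tauOne_sub (p : ℕ) (D E : ℝ →₀ ℤ) : tauOne p (D - E) = tauOne p D - tauOne p E :=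
  Finsupp.sum_sub_index fun _ _ _ => sub_smul _ _ _

lemma tauOnePt_half {p : ℕ} (hp : 2 ≤ p) :
    tauOnePt p (1 / 2) =
      Finsupp.single (1 / 2) 1 + (p : ℤ) • Finsupp.single (1 / 2 / (p : ℝ)) 1 := by
  have hp' : (2 : ℝ) ≤ p := by exact_mod_cast hp
  have h : ¬ (1 / 2 : ℝ) ≤ 1 / ((p : ℝ) + 1) := by
    rw [not_le]
    exact one_div_lt_one_div_of_lt two_pos (by linarith)
  rw [tauOnePt, if_neg h]
  norm_num

lemma tauOnePt_half_div_pow_succ {p : ℕ} (hp : 1 ≤ p) (m : ℕ) :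
    tauOnePt p (1 / 2 / (p : ℝ) ^ (m + 1)) =
      Finsupp.single (1 / 2 / (p : ℝ) ^ m) 1
        + (p : ℤ) • Finsupp.single (1 / 2 / (p : ℝ) ^ (m + 2)) 1 := by
  have hp' : (1 : ℝ) ≤ p := by exact_mod_cast hp
  have hp0 : (p : ℝ) ≠ 0 := by positivity
  have h : 1 / 2 / (p : ℝ) ^ (m + 1) ≤ 1 / ((p : ℝ) + 1) := by
    rw [div_div]
    refine one_div_le_one_div_of_le (by positivity) ?_
    have hle : (p : ℝ) ≤ (p : ℝ) ^ (m + 1) := le_self_pow₀ hp' m.succ_ne_zero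
    linarith
  have hmul : (p : ℝ) * (1 / 2 / (p : ℝ) ^ (m + 1)) = 1 / 2 / (p : ℝ) ^ m := by
    field_simp
    ring
  have hdiv : 1 / 2 / (p : ℝ) ^ (m + 1) / p = 1 / 2 / (p : ℝ) ^ (m + 2) := by
    rw [div_div _ _ (p : ℝ), ← pow_succ]
  rw [tauOnePt, if_pos h, hmul, hdiv]

/-- The linear recurrence satisfied by the divisors `p^m · [p^{-m}/2]`. -/
lemma tauOne_half_div_pow_succ {p : ℕ} (hp : 1 ≤ p) (m : ℕ) :
    tauOne p (Finsupp.single (1 / 2 / (p : ℝ) ^ (m + 1)) ((p : ℤ) ^ (m + 1)))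
        - (p : ℤ) • Finsupp.single (1 / 2 / (p : ℝ) ^ m) ((p : ℤ) ^ m) =
      Finsupp.single (1 / 2 / (p : ℝ) ^ (m + 2)) ((p : ℤ) ^ (m + 2)) := by
  rw [tauOne_single, tauOnePt_half_div_pow_succ hp]
  simp only [smul_add, Finsupp.smul_single, smul_eq_mul, mul_one, ← pow_succ, ← pow_succ']
  abel

lemma tau_succ_sub_tau_half {p : ℕ} (hp : 2 ≤ p) (m : ℕ) :
    tau p (m + 1) (Finsupp.single (1 / 2) 1) - tau p m (Finsupp.single (1 / 2) 1) =
      Finsupp.single (1 / 2 / (p : ℝ) ^ (m + 1)) ((p : ℤ) ^ (m + 1)) := by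
  have h0 : tau p 1 (Finsupp.single (1 / 2) 1) - tau p 0 (Finsupp.single (1 / 2) 1) =
      Finsupp.single (1 / 2 / (p : ℝ) ^ 1) ((p : ℤ) ^ 1) := by
    simp only [tau, id_eq, tauOne_single, tauOnePt_half hp, one_smul, add_sub_cancel_left,
      Finsupp.smul_single, smul_eq_mul, mul_one, pow_one]
  induction m using Nat.twoStepInduction with
  | zero => exact h0
  | one =>
    rw [← tauOne_half_div_pow_succ (by omega), zero_add, ← h0, tauOne_sub]
    simp only [tau, id_eq, pow_zero, div_one]
    abel
  | more m ih ih' =>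
    rw [← tauOne_half_div_pow_succ (by omega), ← ih, ← ih', tauOne_sub, smul_sub]
    simp only [tau]
    abel

theorem stmt_4 (p : ℕ) (hp : p.Prime) (m : ℕ) (hm : 1 ≤ m) :
    tau p m (Finsupp.single ((1 : ℝ) / 2) 1) - tau p (m - 1) (Finsupp.single ((1 : ℝ) / 2) 1)
        = (p : ℤ) ^ m • Finsupp.single ((p : ℝ) ^ (-(m : ℤ)) / 2) 1 ∧
      (∀ y : ℝ,
        0 ≤ (tau p m (Finsupp.single ((1 : ℝ) / 2) 1)
              - tau p (m - 1) (Finsupp.single ((1 : ℝ) / 2) 1)) y) ∧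
      (tau p m (Finsupp.single ((1 : ℝ) / 2) 1)
          - tau p (m - 1) (Finsupp.single ((1 : ℝ) / 2) 1)).support
        = {(p : ℝ) ^ (-(m : ℤ)) / 2} := by
  obtain ⟨n, rfl⟩ := Nat.exists_eq_add_of_le' hm
  have hpt : (p : ℝ) ^ (-((n + 1 : ℕ) : ℤ)) / 2 = 1 / 2 / (p : ℝ) ^ (n + 1) := by
    rw [zpow_neg, zpow_natCast]
    ring
  have hpow : 0 < (p : ℤ) ^ (n + 1) := pow_pos (by exact_mod_cast hp.pos) _
  rw [Nat.add_sub_cancel, tau_succ_sub_tau_half hp.two_le, hpt]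
  refine ⟨by simp, fun y => ?_, Finsupp.support_single _ hpow.ne'⟩
  exact (Finsupp.single_nonneg.2 hpow.le) y
end

section
/- Let p be a prime number. For all integers ℓ ≥ 0 and m₀ ≥ 0, every integer m with 0 ≤ m ≤ m₀, and every x ∈ [x_ℓ, x_0], the support of the divisor τ_m([x]) is contained in the interval [x_{ℓ+m₀}, x_0]. -/
open Finsupp

theorem xk_zero (p : ℕ) : xk p 0 = (p : ℝ) / ((p : ℝ) + 1) := by
  simp [xk]

theorem xk_nonneg (p k : ℕ) : 0 ≤ xk p k := by
  unfold xk; positivity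

theorem xk_succ {p : ℕ} (hp : 0 < p) (k : ℕ) : xk p (k + 1) = xk p k / p := by
  have hp' : (p : ℝ) ≠ 0 := by positivity
  simp only [xk, zpow_neg, zpow_natCast, pow_succ]
  field_simp

theorem xk_one {p : ℕ} (hp : 0 < p) : xk p 1 = 1 / ((p : ℝ) + 1) := by
  have hp' : (p : ℝ) ≠ 0 := by positivity
  rw [xk_succ hp 0, xk_zero]
  field_simp

theorem xk_antitone {p : ℕ} (hp : 0 < p) : Antitone (xk p) :=
  antitone_nat_of_succ_le fun k => by
    rw [xk_succ hp]
    exact div_le_self (xk_nonneg p k) (by exact_mod_cast hp)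

theorem tauOnePt_mem_supported {p : ℕ} (hp : 0 < p) {ℓ : ℕ} {x : ℝ}
    (hx : x ∈ Set.Icc (xk p ℓ) (xk p 0)) :
    tauOnePt p x ∈ Finsupp.supported ℤ ℤ (Set.Icc (xk p (ℓ + 1)) (xk p 0)) := by
  have hp1 : (1 : ℝ) ≤ p := by exact_mod_cast hp
  have hp0 : (0 : ℝ) < p := by positivity
  have hx0 : 0 ≤ x := (xk_nonneg p ℓ).trans hx.1
  have hdiv : x / p ∈ Set.Icc (xk p (ℓ + 1)) (xk p 0) := by
    rw [xk_succ hp]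
    exact ⟨by gcongr; exact hx.1, (div_le_self hx0 hp1).trans hx.2⟩
  unfold tauOnePt
  split_ifs with h
  · refine add_mem (Finsupp.single_mem_supported _ _ ⟨?_, ?_⟩)
      (Submodule.smul_mem _ _ (Finsupp.single_mem_supported _ _ hdiv))
    · exact ((xk_antitone hp ℓ.le_succ).trans hx.1).trans (le_mul_of_one_le_left hx0 hp1)
    · calc (p : ℝ) * x ≤ p * (1 / ((p : ℝ) + 1)) := by gcongr
        _ = xk p 0 := by rw [xk_zero, mul_one_div]
  · have hsum : xk p 0 + xk p 1 = 1 := by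
      rw [xk_zero, xk_one hp]
      field_simp
    rw [← xk_one hp, not_le] at h
    refine add_mem (Finsupp.single_mem_supported _ _ ⟨?_, by linarith⟩)
      (Submodule.smul_mem _ _ (Finsupp.single_mem_supported _ _ hdiv))
    have := xk_antitone hp (Nat.le_add_left 1 ℓ)
    linarith [hx.2]

theorem tauOne_mem_supported {p : ℕ} (hp : 0 < p) {ℓ : ℕ} {D : ℝ →₀ ℤ}
    (hD : D ∈ Finsupp.supported ℤ ℤ (Set.Icc (xk p ℓ) (xk p 0))) :
    tauOne p D ∈ Finsupp.supported ℤ ℤ (Set.Icc (xk p (ℓ + 1)) (xk p 0)) :=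
  Submodule.sum_mem _ fun _ hx =>
    Submodule.smul_mem _ _ (tauOnePt_mem_supported hp (hD hx))

theorem tau_mem_supported {p : ℕ} (hp : 0 < p) {ℓ : ℕ} {D : ℝ →₀ ℤ}
    (hD : D ∈ Finsupp.supported ℤ ℤ (Set.Icc (xk p ℓ) (xk p 0))) (m : ℕ) :
    tau p m D ∈ Finsupp.supported ℤ ℤ (Set.Icc (xk p (ℓ + m)) (xk p 0)) := by
  induction m using Nat.twoStepInduction with
  | zero => exact hD
  | one => exact tauOne_mem_supported hp hD
  | more m ih₀ ih₁ =>
    exact sub_mem (tauOne_mem_supported hp ih₁) (Submodule.smul_mem _ _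
      (Finsupp.supported_mono
        (Set.Icc_subset_Icc_left (xk_antitone hp (by omega))) ih₀))

theorem stmt_7 (p : ℕ) (hp : p.Prime) (ℓ m₀ m : ℕ) (hm : m ≤ m₀) (x : ℝ)
    (hx : x ∈ Set.Icc (xk p ℓ) (xk p 0)) :
    ↑(tau p m (Finsupp.single x 1)).support ⊆ Set.Icc (xk p (ℓ + m₀)) (xk p 0) := by
  exact (tau_mem_supported hp.pos (Finsupp.single_mem_supported ℤ 1 hx) m).trans
    (Set.Icc_subset_Icc_left (xk_antitone hp.pos (by omega)))
end

section
/- Let K be a field complete with respect to a nonarchimedean multiplicative absolute value |·|, let p be a prime number, and let (B_n)_{n≥1} be a sequence in K such that |B_n| ≤ 1 for every n ≥ 1 and |B_n| ≤ 1/p for every n ≠ p. Then for all z, z' ∈ K with |z| < 1, |z'| < 1 and z ≠ z', the series F(z) := Σ_{n≥1} B_n z^n and F(z') := Σ_{n≥1} B_n z'^n converge in K and satisfy |F(z) − F(z')| < |z − z'|. -/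
lemma IsUltrametricDist.norm_pow_succ_sub_pow_succ_le {K : Type*} [NormedField K]
    [IsUltrametricDist K] {z w : K} {r : ℝ} (hz : ‖z‖ ≤ r) (hw : ‖w‖ ≤ r) (n : ℕ) :
    ‖z ^ (n + 1) - w ^ (n + 1)‖ ≤ r ^ n * ‖z - w‖ := by
  have hr : 0 ≤ r := (norm_nonneg z).trans hz
  rw [← geom_sum₂_mul, norm_mul]
  gcongr
  refine IsUltrametricDist.norm_sum_le_of_forall_le_of_nonneg (by positivity) fun i hi => ?_
  have hi' : i ≤ n := Nat.lt_succ_iff.mp (Finset.mem_range.mp hi)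
  calc ‖z ^ i * w ^ (n + 1 - 1 - i)‖ = ‖z‖ ^ i * ‖w‖ ^ (n - i) := by simp
    _ ≤ r ^ i * r ^ (n - i) := by gcongr
    _ = r ^ n := by rw [← pow_add, Nat.add_sub_cancel' hi']

lemma summable_mul_pow_succ_of_norm_le_one {K : Type*} [NormedField K] [CompleteSpace K]
    {B : ℕ → K} (hB : ∀ n : ℕ, 1 ≤ n → ‖B n‖ ≤ 1) {z : K} (hz : ‖z‖ < 1) :
    Summable (fun n : ℕ => B (n + 1) * z ^ (n + 1)) := by
  refine Summable.of_norm_bounded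
    ((summable_nat_add_iff 1).mpr (summable_geometric_of_lt_one (norm_nonneg z) hz)) fun n => ?_
  rw [norm_mul, norm_pow]
  exact mul_le_of_le_one_left (by positivity) (hB _ (Nat.le_add_left 1 n))

theorem stmt_13 (K : Type*) [NormedField K] [IsUltrametricDist K] [CompleteSpace K]
    (p : ℕ) (hp : p.Prime) (B : ℕ → K)
    (hB1 : ∀ n : ℕ, 1 ≤ n → ‖B n‖ ≤ 1)
    (hBp : ∀ n : ℕ, 1 ≤ n → n ≠ p → ‖B n‖ ≤ 1 / (p : ℝ))
    (z z' : K) (hz : ‖z‖ < 1) (hz' : ‖z'‖ < 1) (hne : z ≠ z') :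
    Summable (fun n : ℕ => B (n + 1) * z ^ (n + 1)) ∧
    Summable (fun n : ℕ => B (n + 1) * z' ^ (n + 1)) ∧
    ‖(∑' n : ℕ, B (n + 1) * z ^ (n + 1)) - ∑' n : ℕ, B (n + 1) * z' ^ (n + 1)‖
      < ‖z - z'‖ := by
  have hs := summable_mul_pow_succ_of_norm_le_one hB1 hz
  have hs' := summable_mul_pow_succ_of_norm_le_one hB1 hz'
  refine ⟨hs, hs', ?_⟩
  set r := max ‖z‖ ‖z'‖
  have hr0 : 0 ≤ r := (norm_nonneg z).trans (le_max_left _ _)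
  have hr1 : r < 1 := max_lt hz hz'
  have hp1 : 1 / (p : ℝ) < 1 := by
    rw [one_div]
    exact inv_lt_one_of_one_lt₀ (by exact_mod_cast hp.one_lt)
  have hd : 0 < ‖z - z'‖ := norm_pos_iff.mpr (sub_ne_zero.mpr hne)
  have hcoeff (n : ℕ) : ‖B (n + 1)‖ * r ^ n ≤ max (1 / (p : ℝ)) r := by
    by_cases hn : n + 1 = p
    · have hn0 : n ≠ 0 := by
        have := hp.two_le
        omega
      calc ‖B (n + 1)‖ * r ^ n ≤ r ^ n :=
            mul_le_of_le_one_left (by positivity) (hB1 _ (Nat.le_add_left 1 n))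
        _ ≤ r := pow_le_of_le_one hr0 hr1.le hn0
        _ ≤ _ := le_max_right _ _
    · calc ‖B (n + 1)‖ * r ^ n ≤ ‖B (n + 1)‖ :=
            mul_le_of_le_one_right (norm_nonneg _) (pow_le_one₀ hr0 hr1.le)
        _ ≤ 1 / (p : ℝ) := hBp _ (Nat.le_add_left 1 n) hn
        _ ≤ _ := le_max_left _ _
  rw [← hs.tsum_sub hs']
  calc ‖∑' n : ℕ, (B (n + 1) * z ^ (n + 1) - B (n + 1) * z' ^ (n + 1))‖
      ≤ max (1 / (p : ℝ)) r * ‖z - z'‖ := by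
        refine IsUltrametricDist.norm_tsum_le_of_forall_le_of_nonneg (by positivity) fun n => ?_
        rw [← mul_sub, norm_mul]
        calc ‖B (n + 1)‖ * ‖z ^ (n + 1) - z' ^ (n + 1)‖
            ≤ ‖B (n + 1)‖ * (r ^ n * ‖z - z'‖) := by
              gcongr
              exact IsUltrametricDist.norm_pow_succ_sub_pow_succ_le
                (le_max_left _ _) (le_max_right _ _) n
          _ = ‖B (n + 1)‖ * r ^ n * ‖z - z'‖ := by ring
          _ ≤ _ := by gcongr; exact hcoeff n
    _ < ‖z - z'‖ := mul_lt_of_lt_one_left hd (max_lt hp1 hr1)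
end
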